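/- For all integers M, N with 0 < M < N, setting p = M/N, one has C(N,M)·p^M·(1-p)^(N-M) ≥ 1/√(8πM). -/

import Mathlib

open Real

theorem factorial_le_exp_one_mul_sqrt_mul_pow {n : ℕ} (hn : n ≠ 0) :
    (n.factorial : ℝ) ≤ exp 1 * √n * (n / exp 1) ^ n := by
  obtain ⟨k, rfl⟩ := Nat.exists_eq_succ_of_ne_zero hn
  have h : Stirling.stirlingSeq (k + 1) ≤ exp 1 / √2 := by
    simpa using Stirling.stirlingSeq'_antitone (Nat.zero_le k)
  rw [Stirling.stirlingSeq, div_le_iff₀ (by positivity)] at h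
  refine h.trans_eq ?_
  rw [sqrt_mul (by norm_num)]
  field_simp

theorem exp_one_sq_le_four_mul_pi : exp 1 ^ 2 ≤ 4 * π := by
  nlinarith [exp_one_lt_d9, exp_pos 1, pi_gt_three]

theorem sqrt_div_le_choose_mul_pow_mul_pow {m k : ℕ} (hm : m ≠ 0) (hk : k ≠ 0) :
    √(2 * π * (m + k)) / (exp 1 ^ 2 * √m * √k) ≤
      ((m + k).choose m : ℝ) * (m / (m + k)) ^ m * (k / (m + k)) ^ k := by
  have hm' : (0 : ℝ) < m := by positivity
  have hk' : (0 : ℝ) < k := by positivity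
  have hlow := Stirling.le_factorial_stirling (m + k)
  have hfac : ((m + k).choose m : ℝ) * (m.factorial * k.factorial) = (m + k).factorial := by
    rw [← mul_assoc, Nat.choose_symm_add]
    exact_mod_cast Nat.add_choose_mul_factorial_mul_factorial m k
  have hup := mul_le_mul (factorial_le_exp_one_mul_sqrt_mul_pow hm)
    (factorial_le_exp_one_mul_sqrt_mul_pow hk) (by positivity) (by positivity)
  have h := hlow.trans (hfac.symm.le.trans
    (mul_le_mul_of_nonneg_left hup (Nat.cast_nonneg ((m + k).choose m))))
  push_cast at h
  rw [div_le_iff₀ (by positivity)]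
  refine le_of_mul_le_mul_right (a := ((m + k : ℝ) / exp 1) ^ (m + k)) ?_ (by positivity)
  refine h.trans_eq ?_
  simp only [div_pow, pow_add]
  field_simp

theorem binomial_central_prob_lower_bound
    (M N : ℕ) (hM : 0 < M) (hMN : M < N)
    (p : ℝ) (hp : p = (M : ℝ) / N) :
    (N.choose M : ℝ) * p ^ M * (1 - p) ^ (N - M) ≥ 1 / Real.sqrt (8 * π * M) := by
  obtain ⟨k, rfl⟩ := Nat.exists_eq_add_of_lt hMN
  have hM' : (0 : ℝ) < M := by positivity
  have hq : 1 - p = ((k + 1 : ℕ) : ℝ) / (M + (k + 1 : ℕ)) := by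
    rw [hp]
    push_cast
    field_simp
    ring
  have hp' : p = (M : ℝ) / (M + (k + 1 : ℕ)) := by
    rw [hp]
    push_cast
    ring
  rw [hq, hp', add_assoc, Nat.add_sub_cancel_left]
  refine le_trans ?_ (sqrt_div_le_choose_mul_pow_mul_pow hM.ne' k.succ_ne_zero)
  rw [div_le_div_iff₀ (by positivity) (by positivity), one_mul,
    ← sqrt_mul (by positivity)]
  calc exp 1 ^ 2 * √M * √(k + 1 : ℕ)
      ≤ 4 * π * √M * √(M + (k + 1 : ℕ)) := by
        gcongr
        · exact exp_one_sq_le_four_mul_pi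
        · linarith
    _ = √(2 * π * (M + (k + 1 : ℕ)) * (8 * π * M)) := by
        rw [show 2 * π * (M + (k + 1 : ℕ)) * (8 * π * M) =
          (4 * π) ^ 2 * M * (M + (k + 1 : ℕ)) by ring, sqrt_mul (by positivity),
          sqrt_mul (by positivity), sqrt_sq (by positivity)]
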